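/- Let x0 ∈ 𝔇 and let x : [0,∞) → 𝔇 be differentiable with x(0) = x0, x'(t) = F(x(t)) for all t ≥ 0, and x(t) in the interior of 𝔇 for all t > 0. Write x^i(t) = (x_1^i(t),…,x_d^i(t)) and π^i(x) = (π_1^i(x),…,π_d^i(x)). Then: (a) for every τ > 0 and every i ∈ [m], the derivative at t = τ of t ↦ Ent(x^i(t) / π^i(x(τ))) is ≤ 0 (π^i(x(τ)) held fixed); and (b) there exists τ > 0 such that this derivative equals 0 for every i ∈ [m] if and only if x0 ∈ F^{-1}(0). -/

import Mathlib

open Filter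

def simplexD (d m : ℕ) : Set (Fin m → Fin d → ℝ) :=
  {x | ∀ i, (∀ v, 0 ≤ x i v) ∧ (∑ v, x i v) = 1}

noncomputable def piMap (d m : ℕ) (α : Fin d → Fin m → Fin m → ℝ)
    (x : Fin m → Fin d → ℝ) : Fin m → Fin d → ℝ :=
  fun i v => Real.exp (∑ j, α v i j * x j v) / ∑ u, Real.exp (∑ j, α u i j * x j u)

noncomputable def FF (d m : ℕ) (α : Fin d → Fin m → Fin m → ℝ)
    (x : Fin m → Fin d → ℝ) : Fin m → Fin d → ℝ :=
  fun i v => -(x i v) + piMap d m α x i v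

/-- Relative entropy `Ent(a/b) = Σ_v a_v log (a_v / b_v)` for probability vectors on `[d]`. -/
noncomputable def Ent1 (d : ℕ) (a b : Fin d → ℝ) : ℝ :=
  ∑ v, a v * Real.log (a v / b v)

theorem isCompact_simplexD (d m : ℕ) : IsCompact (simplexD d m) := by
  have h : simplexD d m = Set.univ.pi fun _ : Fin m => stdSimplex ℝ (Fin d) := by
    ext x
    simp [simplexD, stdSimplex, Set.mem_pi]
  rw [h]
  exact isCompact_univ_pi fun _ => isCompact_stdSimplex ℝ (Fin d)

theorem sum_exp_pos {d : ℕ} (hd : 0 < d) (f : Fin d → ℝ) : 0 < ∑ u, Real.exp (f u) := by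
  have : Nonempty (Fin d) := ⟨⟨0, hd⟩⟩
  exact Finset.sum_pos (fun u _ => Real.exp_pos _) Finset.univ_nonempty

theorem piMap_pos {d : ℕ} (hd : 0 < d) (m : ℕ) (α : Fin d → Fin m → Fin m → ℝ)
    (x : Fin m → Fin d → ℝ) (i : Fin m) (v : Fin d) : 0 < piMap d m α x i v :=
  div_pos (Real.exp_pos _) (sum_exp_pos hd _)

theorem sum_piMap {d : ℕ} (hd : 0 < d) (m : ℕ) (α : Fin d → Fin m → Fin m → ℝ)
    (x : Fin m → Fin d → ℝ) (i : Fin m) : ∑ v, piMap d m α x i v = 1 := by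
  simp only [piMap]
  rw [← Finset.sum_div, div_self (sum_exp_pos hd _).ne']

theorem contDiff_FF {d : ℕ} (hd : 0 < d) (m : ℕ) (α : Fin d → Fin m → Fin m → ℝ) :
    ContDiff ℝ 1 (FF d m α) := by
  have hlin (i : Fin m) (u : Fin d) :
      ContDiff ℝ 1 fun x : Fin m → Fin d → ℝ => Real.exp (∑ j, α u i j * x j u) :=
    (ContDiff.sum fun j _ => contDiff_const.mul (contDiff_apply_apply ℝ ℝ j u)).exp
  refine contDiff_pi.2 fun i => contDiff_pi.2 fun v => ?_
  exact (contDiff_apply_apply ℝ ℝ i v).neg.add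
    ((hlin i v).div (ContDiff.sum fun u _ => hlin i u) fun x => (sum_exp_pos hd _).ne')

theorem exists_lipschitzOnWith_FF {d : ℕ} (hd : 0 < d) (m : ℕ)
    (α : Fin d → Fin m → Fin m → ℝ) : ∃ K, LipschitzOnWith K (FF d m α) (simplexD d m) :=
  (contDiff_FF hd m α).locallyLipschitz.locallyLipschitzOn.exists_lipschitzOnWith_of_compact
    (isCompact_simplexD d m)

/-- A trajectory in the simplex product that is at an equilibrium at one time was there from the
start. -/
theorem apply_zero_eq_apply_of_FF_eq_zero {d : ℕ} (hd : 0 < d) (m : ℕ)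
    (α : Fin d → Fin m → Fin m → ℝ) (x : ℝ → Fin m → Fin d → ℝ)
    (hmem : ∀ t, 0 ≤ t → x t ∈ simplexD d m)
    (hder : ∀ t, 0 ≤ t → HasDerivAt x (FF d m α (x t)) t) {τ : ℝ} (hτ : 0 ≤ τ)
    (heq : FF d m α (x τ) = 0) : x 0 = x τ := by
  obtain ⟨K, hK⟩ := exists_lipschitzOnWith_FF hd m α
  refine ODE_solution_unique_of_mem_Icc_left (v := fun _ => FF d m α)
    (s := fun _ => simplexD d m) (g := fun _ => x τ) (fun _ _ => hK)
    (fun t ht => (hder t ht.1).continuousAt.continuousWithinAt)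
    (fun t ht => (hder t ht.1.le).hasDerivWithinAt) (fun t ht => hmem t ht.1.le)
    continuousOn_const (fun t _ => ?_) (fun _ _ => hmem τ hτ) rfl ⟨le_rfl, hτ⟩
  rw [heq]
  exact hasDerivWithinAt_const _ _ _

/-- A trajectory in the simplex product that starts at an equilibrium stays there. -/
theorem apply_eq_apply_zero_of_FF_eq_zero {d : ℕ} (hd : 0 < d) (m : ℕ)
    (α : Fin d → Fin m → Fin m → ℝ) (x : ℝ → Fin m → Fin d → ℝ)
    (hmem : ∀ t, 0 ≤ t → x t ∈ simplexD d m)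
    (hder : ∀ t, 0 ≤ t → HasDerivAt x (FF d m α (x t)) t) {τ : ℝ} (hτ : 0 ≤ τ)
    (heq : FF d m α (x 0) = 0) : x τ = x 0 := by
  obtain ⟨K, hK⟩ := exists_lipschitzOnWith_FF hd m α
  refine ODE_solution_unique_of_mem_Icc_right (v := fun _ => FF d m α)
    (s := fun _ => simplexD d m) (g := fun _ => x 0) (fun _ _ => hK)
    (fun t ht => (hder t ht.1).continuousAt.continuousWithinAt)
    (fun t ht => (hder t ht.1).hasDerivWithinAt) (fun t ht => hmem t ht.1)
    continuousOn_const (fun t _ => ?_) (fun _ _ => hmem 0 le_rfl) rfl ⟨hτ, le_rfl⟩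
  rw [heq]
  exact hasDerivWithinAt_const _ _ _

theorem hasDerivAt_Ent1 {d : ℕ} {a : ℝ → Fin d → ℝ} {a' b : Fin d → ℝ} {τ : ℝ}
    (ha : HasDerivAt a a' τ) (hpos : ∀ v, 0 < a τ v) (hb : ∀ v, 0 < b v) :
    HasDerivAt (fun t => Ent1 d (a t) b)
      (∑ v, a' v * (Real.log (a τ v) - Real.log (b v)) + ∑ v, a' v) τ := by
  rw [← Finset.sum_add_distrib]
  refine HasDerivAt.fun_sum fun v _ => ?_
  have hv := hasDerivAt_pi.1 ha v
  have hlog := (hv.div_const (b v)).log (div_pos (hpos v) (hb v)).ne'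
  refine (hv.mul hlog).congr_deriv ?_
  rw [Real.log_div (hpos v).ne' (hb v).ne']
  have h₁ := (hpos v).ne'
  have h₂ := (hb v).ne'
  field_simp

theorem sub_mul_log_sub_log_nonpos {a b : ℝ} (ha : 0 < a) (hb : 0 < b) :
    (b - a) * (Real.log a - Real.log b) ≤ 0 := by
  rcases le_total a b with h | h
  · exact mul_nonpos_of_nonneg_of_nonpos (sub_nonneg.2 h) (sub_nonpos.2 (Real.log_le_log ha h))
  · exact mul_nonpos_of_nonpos_of_nonneg (sub_nonpos.2 h) (sub_nonneg.2 (Real.log_le_log hb h))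

theorem sub_mul_log_sub_log_eq_zero_iff {a b : ℝ} (ha : 0 < a) (hb : 0 < b) :
    (b - a) * (Real.log a - Real.log b) = 0 ↔ b = a := by
  rw [mul_eq_zero, sub_eq_zero, sub_eq_zero]
  exact ⟨fun h => h.elim id fun h => (Real.log_injOn_pos ha hb h).symm, Or.inl⟩

/-- Along a solution of `x' = F(x)` lying in the interior of `𝔇` for `t > 0`:
(a) for every `τ > 0` and every walk `i`, the derivative at `t = τ` of
`t ↦ Ent(x^i(t)/π^i(x(τ)))` (with `π^i(x(τ))` held fixed) is `≤ 0`; and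
(b) there exists `τ > 0` at which all these derivatives vanish iff `x0` is an
equilibrium of `F`. -/
theorem deriv_Ent_nonpos_and_eq_zero_iff (d m : ℕ) (hd : 2 ≤ d) (hm : 2 ≤ m)
    (α : Fin d → Fin m → Fin m → ℝ) (hsym : ∀ v i j, α v i j = α v j i)
    (x0 : Fin m → Fin d → ℝ) (hx0mem : x0 ∈ simplexD d m)
    (x : ℝ → Fin m → Fin d → ℝ) (hx0 : x 0 = x0)
    (hmem : ∀ t, 0 ≤ t → x t ∈ simplexD d m)
    (hder : ∀ t, 0 ≤ t → HasDerivAt x (FF d m α (x t)) t)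
    (hint : ∀ t, 0 < t → ∀ i v, 0 < x t i v) :
    (∀ τ, 0 < τ → ∀ i : Fin m,
        deriv (fun t => Ent1 d (x t i) (fun v => piMap d m α (x τ) i v)) τ ≤ 0) ∧
    ((∃ τ, 0 < τ ∧ ∀ i : Fin m,
        deriv (fun t => Ent1 d (x t i) (fun v => piMap d m α (x τ) i v)) τ = 0)
      ↔ FF d m α x0 = 0) := by
  have hd' : 0 < d := by omega
  have hderiv : ∀ τ, 0 < τ → ∀ i : Fin m,
      deriv (fun t => Ent1 d (x t i) (fun v => piMap d m α (x τ) i v)) τ =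
        ∑ v, (piMap d m α (x τ) i v - x τ i v) *
          (Real.log (x τ i v) - Real.log (piMap d m α (x τ) i v)) := by
    intro τ hτ i
    rw [(hasDerivAt_Ent1 (hasDerivAt_pi.1 (hder τ hτ.le) i) (hint τ hτ i)
      (piMap_pos hd' m α (x τ) i)).deriv]
    have hsum : ∑ v, FF d m α (x τ) i v = 0 := by
      simp only [FF]
      rw [Finset.sum_add_distrib, Finset.sum_neg_distrib, sum_piMap hd', (hmem τ hτ.le i).2]
      norm_num
    rw [hsum, add_zero]
    exact Finset.sum_congr rfl fun v _ => by rw [FF, neg_add_eq_sub]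
  have hterm : ∀ τ, 0 < τ → ∀ i v, (piMap d m α (x τ) i v - x τ i v) *
      (Real.log (x τ i v) - Real.log (piMap d m α (x τ) i v)) ≤ 0 := fun τ hτ i v =>
    sub_mul_log_sub_log_nonpos (hint τ hτ i v) (piMap_pos hd' m α (x τ) i v)
  have hzero : ∀ τ, 0 < τ → ((∀ i : Fin m,
      deriv (fun t => Ent1 d (x t i) (fun v => piMap d m α (x τ) i v)) τ = 0) ↔
        FF d m α (x τ) = 0) := by
    intro τ hτ
    rw [funext_iff]
    refine forall_congr' fun i => ?_
    rw [hderiv τ hτ i, Finset.sum_eq_zero_iff_of_nonpos fun v _ => hterm τ hτ i v, funext_iff]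
    refine forall_congr' fun v => ?_
    rw [sub_mul_log_sub_log_eq_zero_iff (hint τ hτ i v) (piMap_pos hd' m α (x τ) i v)]
    simp [FF, neg_add_eq_zero, eq_comm]
  refine ⟨fun τ hτ i => ?_, ?_, fun h => ⟨1, one_pos, (hzero 1 one_pos).2 ?_⟩⟩
  · rw [hderiv τ hτ i]
    exact Finset.sum_nonpos fun v _ => hterm τ hτ i v
  · rintro ⟨τ, hτ, h⟩
    have h' := (hzero τ hτ).1 h
    rw [← hx0, apply_zero_eq_apply_of_FF_eq_zero hd' m α x hmem hder hτ.le h', h']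
  · rw [← hx0] at h
    rw [apply_eq_apply_zero_of_FF_eq_zero hd' m α x hmem hder zero_le_one h, h]
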